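/- arXiv:2505.12817 — 6 statements merged into one kernel-verified Lean document; each statement's English description precedes it below -/
import Mathlib

section
/- Let B_R ⊂ ℂ² ≅ ℝ⁴ be the open ball of radius R > 0 centered at the origin and let λ > 0. Suppose u is smooth on B_R, of class C^{1,1} on the closed ball, radially symmetric (u(x) = f(|x|) for some function f), plurisubharmonic on B_R (the complex Hessian (∂²u/∂z_i∂z̄_j)_{1≤i,j≤2} is positive semidefinite), and satisfies det(∂²u/∂z_i∂z̄_j)_{1≤i,j≤2} = λ·(−u)² in B_R, with u < 0 in B_R and u = 0 on ∂B_R. Then v = −log(−u/4) is strictly convex in B_R, i.e. its real Hessian is positive definite at every point of B_R. -/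
open scoped ComplexOrder

/-- First-order real partial derivative `∂f/∂xᵢ` on `ℝ⁴ ≅ ℂ²`. -/
noncomputable def pd (f : (Fin 4 → ℝ) → ℝ) (i : Fin 4) (x : Fin 4 → ℝ) : ℝ :=
  fderiv ℝ f x (Pi.single i 1)

/-- Second-order real partial derivative `∂²f/∂xᵢ∂xⱼ`. -/
noncomputable def pd2 (f : (Fin 4 → ℝ) → ℝ) (i j : Fin 4) (x : Fin 4 → ℝ) : ℝ :=
  pd (fun y => pd f i y) j x

/-- The real Hessian matrix of `f` at `x`. -/
noncomputable def hessM (f : (Fin 4 → ℝ) → ℝ) (x : Fin 4 → ℝ) :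
    Matrix (Fin 4) (Fin 4) ℝ :=
  Matrix.of fun i j => pd2 f i j x

/-- Index of the real part of `z_i` under `z₁ = x₁ + i x₃`, `z₂ = x₂ + i x₄`. -/
def xi : Fin 2 → Fin 4 := ![0, 1]

/-- Index of the imaginary part of `z_i`. -/
def yi : Fin 2 → Fin 4 := ![2, 3]

/-- The complex Hessian `(∂²u/∂z_i∂z̄_j)_{1≤i,j≤2}` of a real-valued function on
`ℝ⁴ ≅ ℂ²`. -/
noncomputable def cHess (u : (Fin 4 → ℝ) → ℝ) (x : Fin 4 → ℝ) :
    Matrix (Fin 2) (Fin 2) ℂ := fun i j =>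
  (1/4 : ℂ) * (((pd2 u (xi i) (xi j) x + pd2 u (yi i) (yi j) x : ℝ) : ℂ)
    + Complex.I * ((pd2 u (xi i) (yi j) x - pd2 u (yi i) (xi j) x : ℝ) : ℂ))

/-- The open Euclidean ball of radius `R` about the origin in `ℝ⁴ ≅ ℂ²`. -/
def euclBall (R : ℝ) : Set (Fin 4 → ℝ) := {x | ∑ i, (x i)^2 < R^2}

/-- The closed Euclidean ball of radius `R` about the origin in `ℝ⁴ ≅ ℂ²`. -/
def euclClosedBall (R : ℝ) : Set (Fin 4 → ℝ) := {x | ∑ i, (x i)^2 ≤ R^2}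

/-- The Euclidean sphere of radius `R` about the origin in `ℝ⁴ ≅ ℂ²`. -/
def euclSphere (R : ℝ) : Set (Fin 4 → ℝ) := {x | ∑ i, (x i)^2 = R^2}

open Set Filter Topology

/-- Along `s p' = λ/p - p + s p²` with `p(0+)² = λ > 0`, the function `s p²` is strictly
increasing. -/
lemma pos_add_two_mul_deriv_of_ode {S lam p₀ : ℝ} {p : ℝ → ℝ} (hlam : 0 < lam)
    (hp : ∀ s ∈ Ioo 0 S, 0 < p s) (hd : ∀ s ∈ Ioo 0 S, DifferentiableAt ℝ p s)
    (hode : ∀ s ∈ Ioo 0 S, p s * (p s + s * (deriv p s - p s ^ 2)) = lam)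
    (hlim : Tendsto p (𝓝[>] 0) (𝓝 p₀)) (hp₀ : p₀ ^ 2 = lam) :
    ∀ s ∈ Ioo 0 S, 0 < p s + 2 * s * deriv p s := by
  intro b hb
  set Φ : ℝ → ℝ := fun s => 2 * lam - p s ^ 2 + 2 * s * p s ^ 3 with hΦ
  have hΦp : ∀ s ∈ Ioo 0 S, Φ s = p s * (p s + 2 * s * deriv p s) := by
    intro s hs
    have := hode s hs
    simp only [hΦ]
    linear_combination (-2) * this
  have hΦd : ∀ s ∈ Ioo 0 S, HasDerivAt Φ
      (-(2 * p s * deriv p s) + (2 * p s ^ 3 + 2 * s * (3 * p s ^ 2 * deriv p s))) s := by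
    intro s hs
    have h := (hd s hs).hasDerivAt
    refine (((h.pow 2).const_sub (2 * lam)).add
      (((hasDerivAt_id s).const_mul 2).mul (h.pow 3))).congr_deriv ?_
    simp
  have hpos : ∀ s ∈ Ioo 0 S, Φ s = 0 →
      0 < -(2 * p s * deriv p s) + (2 * p s ^ 3 + 2 * s * (3 * p s ^ 2 * deriv p s)) := by
    intro s hs h0
    have hps := hp s hs
    have hs0 : 0 < s := hs.1
    have h1 : p s + 2 * s * deriv p s = 0 := by
      have := hΦp s hs
      rw [h0] at this
      exact (mul_eq_zero.1 this.symm).resolve_left hps.ne'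
    have h2 : deriv p s = -p s / (2 * s) := by
      field_simp
      linarith
    have h3 : s * p s < 1 := by
      by_contra hcon
      have h4 : 2 * lam - p s ^ 2 + 2 * s * p s ^ 3 = 0 := h0
      nlinarith [mul_nonneg (sub_nonneg.2 (not_lt.1 hcon)) (sq_nonneg (p s)), sq_nonneg (p s)]
    have h5 : -(2 * p s * deriv p s) + (2 * p s ^ 3 + 2 * s * (3 * p s ^ 2 * deriv p s))
        = p s ^ 2 * (1 - s * p s) / s := by
      rw [h2]
      field_simp
      ring
    rw [h5]
    have := sub_pos.2 h3
    positivity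
  have hlimΦ : Tendsto Φ (𝓝[>] 0) (𝓝 lam) := by
    have hid : Tendsto (fun s : ℝ => s) (𝓝[>] 0) (𝓝 0) := nhdsWithin_le_nhds
    have := ((hlim.pow 2).const_sub (2 * lam)).add ((hid.const_mul 2).mul (hlim.pow 3))
    convert this using 2
    rw [hp₀]
    ring
  have hnonneg : ∀ s ∈ Ioo 0 S, 0 ≤ Φ s := by
    intro s hs
    obtain ⟨a, ha, ha0, has⟩ := ((hlimΦ.eventually (lt_mem_nhds hlam)).and
      (Ioo_mem_nhdsGT hs.1)).exists
    have hsub : ∀ x ∈ Icc a s, x ∈ Ioo 0 S := fun x hx =>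
      ⟨ha0.trans_le hx.1, hx.2.trans_lt hs.2⟩
    have := image_le_of_deriv_right_lt_deriv_boundary (f := fun x => -Φ x)
      (B := fun _ => 0) (B' := fun _ => 0) (a := a) (b := s)
      (fun x hx => ((hΦd x (hsub x hx)).continuousAt.neg).continuousWithinAt)
      (fun x hx => ((hΦd x (hsub x (Ico_subset_Icc_self hx))).neg).hasDerivWithinAt)
      (by simpa using ha.le) (fun x => hasDerivAt_const x (0 : ℝ))
      (fun x hx h0 => by
        have := hpos x (hsub x (Ico_subset_Icc_self hx)) (by simpa using h0)
        linarith) (right_mem_Icc.2 has.le)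
    simpa using this
  have hne : Φ b ≠ 0 := by
    intro h0
    have hmin : IsLocalMin Φ b := by
      filter_upwards [Ioo_mem_nhds hb.1 hb.2] with y hy
      rw [h0]
      exact hnonneg y hy
    exact (hpos b hb h0).ne' (hmin.hasDerivAt_eq_zero (hΦd b hb))
  have : 0 < Φ b := lt_of_le_of_ne (hnonneg b hb) hne.symm
  rw [hΦp b hb] at this
  exact pos_of_mul_pos_right this (hp b hb).le

lemma hasFDerivAt_sum_sq (x : Fin 4 → ℝ) :
    HasFDerivAt (fun y : Fin 4 → ℝ => ∑ i, y i ^ 2)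
      (∑ i, (2 * x i) • (ContinuousLinearMap.proj i : (Fin 4 → ℝ) →L[ℝ] ℝ)) x := by
  refine HasFDerivAt.fun_sum fun i _ => ?_
  have h : HasFDerivAt (fun y : Fin 4 → ℝ => y i)
    (ContinuousLinearMap.proj i : (Fin 4 → ℝ) →L[ℝ] ℝ) x := hasFDerivAt_apply i x
  simpa using h.pow 2

lemma pd_radial {F : (Fin 4 → ℝ) → ℝ} {g : ℝ → ℝ} {x : Fin 4 → ℝ}
    (hF : F =ᶠ[𝓝 x] fun y => g (∑ i, y i ^ 2)) (hg : DifferentiableAt ℝ g (∑ i, x i ^ 2))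
    (i : Fin 4) : pd F i x = 2 * x i * deriv g (∑ i, x i ^ 2) := by
  have h := hg.hasDerivAt.comp_hasFDerivAt x (hasFDerivAt_sum_sq x)
  have h' : HasFDerivAt F _ x := h.congr_of_eventuallyEq hF
  rw [pd, h'.fderiv]
  simp [Pi.single_apply]
  ring

lemma pd2_radial {F : (Fin 4 → ℝ) → ℝ} {g : ℝ → ℝ} {x : Fin 4 → ℝ}
    (hF : F =ᶠ[𝓝 x] fun y => g (∑ i, y i ^ 2)) (hg : ContDiffAt ℝ 2 g (∑ i, x i ^ 2))
    (i j : Fin 4) : pd2 F i j x = 4 * deriv (deriv g) (∑ i, x i ^ 2) * x i * x j +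
      if i = j then 2 * deriv g (∑ i, x i ^ 2) else 0 := by
  have hev : (fun y => pd F i y) =ᶠ[𝓝 x] fun y => 2 * y i * deriv g (∑ i, y i ^ 2) := by
    have hd : ∀ᶠ s in 𝓝 (∑ i, x i ^ 2), DifferentiableAt ℝ g s :=
      (hg.eventually (by simp)).mono fun s hs => hs.differentiableAt (by simp)
    have hc : ContinuousAt (fun y : Fin 4 → ℝ => ∑ i, y i ^ 2) x :=
      (hasFDerivAt_sum_sq x).continuousAt
    filter_upwards [hF.eventually_nhds, hc.eventually hd] with y hy hy'
    exact pd_radial hy hy' i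
  have hg' : HasDerivAt (deriv g) (deriv (deriv g) (∑ i, x i ^ 2)) (∑ i, x i ^ 2) := by
    have h1 : ContDiffAt ℝ 1 (deriv g) (∑ i, x i ^ 2) := by
      have h2 : ContDiffAt ℝ 1 (fderiv ℝ g) (∑ i, x i ^ 2) :=
        hg.fderiv_right (by norm_num)
      exact h2.clm_apply contDiffAt_const
    exact (h1.differentiableAt (by simp)).hasDerivAt
  have hx : HasFDerivAt (fun y : Fin 4 → ℝ => 2 * y i)
      ((2 : ℝ) • (ContinuousLinearMap.proj i : (Fin 4 → ℝ) →L[ℝ] ℝ)) x :=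
    (hasFDerivAt_apply (𝕜 := ℝ) i x).const_mul 2
  have h := (hx.mul (hg'.comp_hasFDerivAt x (hasFDerivAt_sum_sq x))).congr_of_eventuallyEq hev
  rw [pd2, pd, h.fderiv]
  simp [Pi.single_apply]
  ring_nf

lemma continuousAt_pd2 {F : (Fin 4 → ℝ) → ℝ} {x : Fin 4 → ℝ} (hF : ContDiffAt ℝ 2 F x)
    (i j : Fin 4) : ContinuousAt (pd2 F i j) x := by
  have h1 : ContDiffAt ℝ 1 (pd F i) x :=
    (hF.fderiv_right (m := 1) (by norm_num)).clm_apply contDiffAt_const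
  have h2 : ContDiffAt ℝ 0 (pd2 F i j) x :=
    (h1.fderiv_right (m := 0) (by norm_num)).clm_apply contDiffAt_const
  exact h2.continuousAt

lemma sum_single_sqrt_sq (k : Fin 4) {s : ℝ} (hs : 0 ≤ s) :
    ∑ i, (Pi.single k √s : Fin 4 → ℝ) i ^ 2 = s := by
  simp [Pi.single_apply, ite_pow, Real.sq_sqrt hs]

lemma tendsto_single_sqrt (k : Fin 4) :
    Tendsto (fun s : ℝ => (Pi.single k √s : Fin 4 → ℝ)) (𝓝[>] 0) (𝓝 0) := by
  have h : Continuous fun s : ℝ => (Pi.single k √s : Fin 4 → ℝ) :=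
    (continuous_single k).comp Real.continuous_sqrt
  have := h.tendsto 0
  simp only [Real.sqrt_zero, Pi.single_zero] at this
  exact this.mono_left nhdsWithin_le_nhds

section RadialAtZero

variable {F : (Fin 4 → ℝ) → ℝ} {g : ℝ → ℝ} {S : ℝ}

lemma tendsto_deriv_radial (hS : 0 < S) (hF : ∀ x, F x = g (∑ i, x i ^ 2))
    (hg : ∀ s ∈ Ioo 0 S, ContDiffAt ℝ 2 g s) (hF0 : ContDiffAt ℝ 2 F 0) (i : Fin 4) :
    Tendsto (fun s => 2 * deriv g s) (𝓝[>] 0) (𝓝 (pd2 F i i 0)) := by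
  obtain ⟨k, hk⟩ := exists_ne i
  refine ((continuousAt_pd2 hF0 i i).tendsto.comp (tendsto_single_sqrt k)).congr' ?_
  filter_upwards [Ioo_mem_nhdsGT hS] with s hs
  have hsum := sum_single_sqrt_sq k hs.1.le
  have := pd2_radial (x := Pi.single k √s) (Eventually.of_forall hF)
    (by rw [hsum]; exact hg s hs) i i
  rw [hsum] at this
  simp [this, Pi.single_eq_of_ne hk.symm]

lemma pd2_radial_zero_of_ne (hS : 0 < S) (hF : ∀ x, F x = g (∑ i, x i ^ 2))
    (hg : ∀ s ∈ Ioo 0 S, ContDiffAt ℝ 2 g s) (hF0 : ContDiffAt ℝ 2 F 0) {i j : Fin 4}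
    (hij : i ≠ j) : pd2 F i j 0 = 0 := by
  refine tendsto_nhds_unique
    ((continuousAt_pd2 hF0 i j).tendsto.comp (tendsto_single_sqrt i)) ?_
  refine tendsto_const_nhds.congr' ?_
  filter_upwards [Ioo_mem_nhdsGT hS] with s hs
  have hsum := sum_single_sqrt_sq i hs.1.le
  have := pd2_radial (x := Pi.single i √s) (Eventually.of_forall hF)
    (by rw [hsum]; exact hg s hs) i j
  rw [hsum] at this
  simp [this, hij]

end RadialAtZero

lemma posDef_of_radial {a b : ℝ} {x : Fin 4 → ℝ} {M : Matrix (Fin 4) (Fin 4) ℝ}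
    (hM : ∀ i j, M i j = 4 * b * x i * x j + if i = j then 2 * a else 0)
    (ha : 0 < a) (hab : 0 < a + 2 * (∑ i, x i ^ 2) * b) : M.PosDef := by
  refine Matrix.PosDef.of_dotProduct_mulVec_pos ?_ ?_
  · ext i j
    simp only [Matrix.conjTranspose_apply, hM, star_trivial, eq_comm (a := j)]
    ring
  · intro y hy
    have hquad : star y ⬝ᵥ M.mulVec y =
        2 * a * (∑ i, y i ^ 2) + 4 * b * (∑ i, x i * y i) ^ 2 := by
      simp only [dotProduct, Matrix.mulVec, hM, Fin.sum_univ_four, star_trivial]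
      simp
      ring
    have hy2 : 0 < ∑ i, y i ^ 2 := by
      obtain ⟨k, hk⟩ := Function.ne_iff.1 hy
      exact Finset.sum_pos' (fun i _ => sq_nonneg _) ⟨k, Finset.mem_univ k, sq_pos_of_ne_zero hk⟩
    have hcs : (∑ i, x i * y i) ^ 2 ≤ (∑ i, x i ^ 2) * ∑ i, y i ^ 2 :=
      Finset.sum_mul_sq_le_sq_mul_sq _ _ _
    rw [hquad]
    rcases le_or_gt 0 b with hb | hb
    · positivity
    · nlinarith [mul_pos hab hy2, mul_le_mul_of_nonpos_left hcs hb.le]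

/-- The conditions on the complex Hessian, when the real Hessian is diagonal with three equal
entries. -/
lemma cHess_diagonal {u : (Fin 4 → ℝ) → ℝ} {x : Fin 4 → ℝ} {a b : ℝ} {c : ℝ} (hc : 0 < c)
    (hM : ∀ i j, pd2 u i j x = if i = j then (if i = 0 then 4 * b + 2 * a else 2 * a) else 0)
    (hpsd : (cHess u x).PosSemidef) (hdet : (cHess u x).det = ((c : ℝ) : ℂ)) :
    0 < a ∧ a * (a + b) = c := by
  have h11 : cHess u x 1 1 = ((a : ℝ) : ℂ) := by
    simp [cHess, xi, yi, hM]
    ring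
  have h00 : cHess u x 0 0 = ((a + b : ℝ) : ℂ) := by
    simp [cHess, xi, yi, hM]
    ring
  have h01 : cHess u x 0 1 = 0 := by
    simp [cHess, xi, yi, hM]
  rw [Matrix.det_fin_two, h11, h00, h01, zero_mul, sub_zero] at hdet
  have hdet' : a * (a + b) = c := by
    rw [mul_comm]
    exact_mod_cast hdet
  have ha : 0 ≤ a := by
    have := hpsd.diag_nonneg (i := 1)
    rw [h11] at this
    exact_mod_cast this
  refine ⟨lt_of_le_of_ne ha ?_, hdet'⟩
  rintro rfl
  simp at hdet'
  exact hc.ne hdet'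

/-- the radially symmetric eigenfunction of the complex
Monge–Ampère operator on a ball `B_R ⊂ ℂ² ≅ ℝ⁴` is log-concave:
`v = −log(−u/4)` has positive definite real Hessian in `B_R`. -/
theorem log_concavity_on_ball
    (R : ℝ) (hR : 0 < R) (lam : ℝ) (hlam : 0 < lam)
    (u : (Fin 4 → ℝ) → ℝ)
    (hsmooth : ContDiffOn ℝ (⊤ : ℕ∞) u (euclBall R))
    -- `u ∈ C^{1,1}` on the closed ball
    (hC1 : ContDiffOn ℝ 1 u (euclClosedBall R))
    (hC11 : ∃ K : NNReal,
      LipschitzOnWith K (fun x => fderivWithin ℝ u (euclClosedBall R) x)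
        (euclClosedBall R))
    -- radial symmetry
    (hrad : ∃ f : ℝ → ℝ, ∀ x, u x = f (Real.sqrt (∑ i, (x i)^2)))
    -- plurisubharmonicity
    (hpsh : ∀ x ∈ euclBall R, (cHess u x).PosSemidef)
    -- the complex Monge–Ampère eigenvalue equation
    (heq : ∀ x ∈ euclBall R, (cHess u x).det = ((lam * (-(u x))^2 : ℝ) : ℂ))
    (hneg : ∀ x ∈ euclBall R, u x < 0)
    (hbdry : ∀ x ∈ euclSphere R, u x = 0) :
    ∀ x ∈ euclBall R, (hessM (fun y => -Real.log (-(u y)/4)) x).PosDef := by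
  intro x hx
  obtain ⟨f, hf⟩ := hrad
  set g : ℝ → ℝ := fun s => f √s with hg
  have hug : ∀ y, u y = g (∑ i, y i ^ 2) := hf
  set v : (Fin 4 → ℝ) → ℝ := fun y => -Real.log (-(u y) / 4) with hv
  set h : ℝ → ℝ := fun s => -Real.log (-(g s) / 4) with hh
  have hvh : ∀ y, v y = h (∑ i, y i ^ 2) := fun y => by simp only [hv, hh, hug]
  have hS : 0 < R ^ 2 := by positivity
  have hopen : IsOpen (euclBall R) :=
    isOpen_lt (by fun_prop) continuous_const
  have huC : ∀ y ∈ euclBall R, ContDiffAt ℝ 2 u y := fun y hy =>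
    (hsmooth.contDiffAt (hopen.mem_nhds hy)).of_le (WithTop.coe_le_coe.2 le_top)
  have hlogC : ∀ t : ℝ, t < 0 → ContDiffAt ℝ 2 (fun t : ℝ => -Real.log (-t / 4)) t :=
    fun t ht => ((contDiffAt_id.neg.div_const 4).log (by simp; linarith)).neg
  have hvC : ∀ y ∈ euclBall R, ContDiffAt ℝ 2 v y := fun y hy =>
    (hlogC (u y) (hneg y hy)).comp y (huC y hy)
  have hmem : ∀ s ∈ Ico 0 (R ^ 2), (Pi.single 0 √s : Fin 4 → ℝ) ∈ euclBall R := fun s hs => by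
    simpa only [euclBall, mem_ofPred_eq, sum_single_sqrt_sq 0 hs.1] using hs.2
  have hgu : ∀ s, 0 ≤ s → g s = u (Pi.single 0 √s) := fun s hs => by
    rw [hug, sum_single_sqrt_sq 0 hs]
  have hgC : ∀ s ∈ Ioo 0 (R ^ 2), ContDiffAt ℝ 2 g s := by
    intro s hs
    have h1 : ContDiffAt ℝ 2 (fun s : ℝ => (Pi.single 0 √s : Fin 4 → ℝ)) s :=
      (ContinuousLinearMap.single ℝ (fun _ : Fin 4 => ℝ) 0).contDiff.contDiffAt.comp s
        (Real.contDiffAt_sqrt hs.1.ne')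
    refine ((huC _ (hmem s ⟨hs.1.le, hs.2⟩)).comp s h1).congr_of_eventuallyEq ?_
    filter_upwards [lt_mem_nhds hs.1] with t ht using hgu t ht.le
  have hgneg : ∀ s ∈ Ico 0 (R ^ 2), g s < 0 := fun s hs => by
    rw [hgu s hs.1]
    exact hneg _ (hmem s hs)
  have hhC : ∀ s ∈ Ioo 0 (R ^ 2), ContDiffAt ℝ 2 h s := fun s hs =>
    (hlogC (g s) (hgneg s ⟨hs.1.le, hs.2⟩)).comp s (hgC s hs)
  set p : ℝ → ℝ := fun s => -(deriv g s) / g s with hp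
  have hg1 : ∀ s ∈ Ioo 0 (R ^ 2), HasDerivAt g (deriv g s) s := fun s hs =>
    ((hgC s hs).differentiableAt (by simp)).hasDerivAt
  have hg2 : ∀ s ∈ Ioo 0 (R ^ 2), HasDerivAt (deriv g) (deriv (deriv g) s) s := fun s hs =>
    ((((hgC s hs).fderiv_right (m := 1) (by norm_num)).clm_apply
      contDiffAt_const).differentiableAt (by simp)).hasDerivAt
  have hh1 : ∀ s ∈ Ioo 0 (R ^ 2), deriv h s = p s := by
    intro s hs
    have hgs := hgneg s ⟨hs.1.le, hs.2⟩
    have := (((hg1 s hs).neg.div_const 4).log (by simp; linarith)).neg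
    refine this.deriv.trans ?_
    have := hgs.ne
    simp only [hp, Pi.neg_apply]
    field_simp
  have hp1 : ∀ s ∈ Ioo 0 (R ^ 2), HasDerivAt p (-deriv (deriv g) s / g s + p s ^ 2) s := by
    intro s hs
    have hgs := (hgneg s ⟨hs.1.le, hs.2⟩).ne
    refine ((hg2 s hs).neg.div (hg1 s hs) hgs).congr_deriv ?_
    simp only [hp, Pi.neg_apply]
    field_simp
    ring
  have hh2 : ∀ s ∈ Ioo 0 (R ^ 2), deriv (deriv h) s = deriv p s := by
    intro s hs
    refine EventuallyEq.deriv_eq ?_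
    filter_upwards [Ioo_mem_nhds hs.1 hs.2] with t ht using hh1 t ht
  have hga : ∀ s ∈ Ioo 0 (R ^ 2), 0 < deriv g s ∧
      deriv g s * (deriv g s + s * deriv (deriv g) s) = lam * g s ^ 2 := by
    intro s hs
    have hs' : s ∈ Ico 0 (R ^ 2) := ⟨hs.1.le, hs.2⟩
    have hgs := (hgneg s hs').ne
    have hsum := sum_single_sqrt_sq 0 hs.1.le
    refine cHess_diagonal (by positivity) (fun i j => ?_) (hpsh _ (hmem s hs'))
      (by rw [heq _ (hmem s hs'), ← hgu s hs.1.le, neg_sq])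
    rw [pd2_radial (Eventually.of_forall hug) (by rw [hsum]; exact hgC s hs), hsum]
    have hsq : √s * √s = s := Real.mul_self_sqrt hs.1.le
    by_cases hij : i = j
    · subst hij
      by_cases hi : i = 0
      · subst hi
        simp [mul_assoc, hsq]
        ring
      · simp [hi]
    · by_cases hi : i = 0
      · have hj : j ≠ 0 := fun hj => hij (hi.trans hj.symm)
        simp [hij, hj]
      · simp [hij, hi]
  have h0mem : (0 : Fin 4 → ℝ) ∈ euclBall R := by simpa using hmem 0 ⟨le_rfl, hS⟩
  have hu0 := hneg 0 h0mem
  have hlimg := tendsto_deriv_radial hS hug hgC (huC 0 h0mem)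
  have hlimh := tendsto_deriv_radial hS hvh hhC (hvC 0 h0mem)
  set c := pd2 u 0 0 0 with hc
  have hcc : ∀ i, pd2 u i i 0 = c := fun i => tendsto_nhds_unique (hlimg i) (hlimg 0)
  obtain ⟨hc0, hcl⟩ := cHess_diagonal (u := u) (x := 0) (a := c / 2) (b := 0)
    (c := lam * (-(u 0)) ^ 2) (mul_pos hlam (pow_pos (neg_pos.2 hu0) 2)) (fun i j => by
      by_cases hij : i = j
      · subst hij
        simp [hcc]
        ring
      · simp [hij, pd2_radial_zero_of_ne hS hug hgC (huC 0 h0mem) hij])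
    (hpsh 0 h0mem) (heq 0 h0mem)
  have hgcont : Tendsto g (𝓝[>] 0) (𝓝 (u 0)) := by
    refine ((huC 0 h0mem).continuousAt.tendsto.comp (tendsto_single_sqrt 0)).congr' ?_
    filter_upwards [self_mem_nhdsWithin] with s hs using (hgu s (le_of_lt hs)).symm
  have hplim : Tendsto p (𝓝[>] 0) (𝓝 (-(c / 2) / u 0)) := by
    refine Tendsto.div (Tendsto.neg ?_) hgcont hu0.ne
    simpa using (hlimg 0).div_const 2
  have hppos : ∀ s ∈ Ioo 0 (R ^ 2), 0 < p s := fun s hs =>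
    div_pos_of_neg_of_neg (neg_neg_of_pos (hga s hs).1) (hgneg s ⟨hs.1.le, hs.2⟩)
  have hkey := pos_add_two_mul_deriv_of_ode hlam hppos
    (fun s hs => (hp1 s hs).differentiableAt) (fun s hs => by
      have hgs := (hgneg s ⟨hs.1.le, hs.2⟩).ne
      have := (hga s hs).2
      rw [(hp1 s hs).deriv]
      simp only [hp]
      field_simp
      linear_combination g s * this) hplim (by
      have := hu0.ne
      field_simp
      linear_combination 4 * hcl)
  by_cases hx0 : x = 0
  · subst hx0
    have hd : ∀ i, pd2 v i i 0 = 2 * (-(c / 2) / u 0) := fun i => by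
      refine tendsto_nhds_unique (hlimh i) ((hplim.const_mul 2).congr' ?_)
      filter_upwards [Ioo_mem_nhdsGT hS] with s hs
      rw [hh1 s hs]
    have hpos : 0 < -(c / 2) / u 0 := div_pos_of_neg_of_neg (by linarith) hu0
    refine posDef_of_radial (x := 0) (b := 0) (fun i j => ?_) hpos (by simpa using hpos)
    simp only [hessM, Matrix.of_apply]
    by_cases hij : i = j
    · subst hij
      simp [hd]
    · simp [hij, pd2_radial_zero_of_ne hS hvh hhC (hvC 0 h0mem) hij]
  · have hs : ∑ i, x i ^ 2 ∈ Ioo 0 (R ^ 2) := by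
      refine ⟨?_, hx⟩
      obtain ⟨k, hk⟩ := Function.ne_iff.1 hx0
      exact Finset.sum_pos' (fun i _ => sq_nonneg _) ⟨k, Finset.mem_univ k, sq_pos_of_ne_zero hk⟩
    refine posDef_of_radial (fun i j => ?_) (hppos _ hs) (hkey _ hs)
    rw [hessM, Matrix.of_apply, pd2_radial (Eventually.of_forall hvh) (hhC _ hs), hh1 _ hs,
      hh2 _ hs]
end

section
/- Let λ > 0, R > 0, and let v be a real-valued function on [0, R) that is C² on [0, R) (one-sided derivatives at 0) and C³ on (0, R). Assume v'(0) = 0, v''(0) > 0, and that for every r ∈ (0, R): r·v'(r)·v''(r) − r·v'(r)³ + v'(r)² = 8λr² and v''(r) − v'(r)² + 3·v'(r)/r > 0. Then v''(r) > 0 for all r ∈ [0, R). -/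
open Set Filter Topology

/-- On `[0,R)`, derivatives within `[0,R)` and within `[0,∞)` coincide. -/
lemma derivWithin_Ico_eq_derivWithin_Ici {R x : ℝ} (f : ℝ → ℝ) (hx : x ∈ Ico 0 R) :
    derivWithin f (Ico 0 R) x = derivWithin f (Ici 0) x := by
  apply derivWithin_congr_set
  filter_upwards [Iio_mem_nhds hx.2] with y hy
  exact propext ⟨fun h => h.1, fun h => ⟨h, hy⟩⟩

/-- A function that vanishes at `a` with positive derivative there is negative just to the
left of `a`. -/
lemma HasDerivAt.eventually_neg_left {g : ℝ → ℝ} {a c : ℝ} (hg : HasDerivAt g c a)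
    (hc : 0 < c) (ha : g a = 0) : ∀ᶠ x in 𝓝[<] a, g x < 0 := by
  have h : Tendsto (slope g a) (𝓝[<] a) (𝓝 c) :=
    hg.tendsto_slope.mono_left (nhdsWithin_mono a fun x hx => ne_of_lt hx)
  filter_upwards [h.eventually (lt_mem_nhds hc), self_mem_nhdsWithin] with x hx hxa
  rw [slope_def_field, ha, sub_zero] at hx
  exact (div_pos_iff.1 hx).resolve_left (fun h => (sub_pos.1 h.2).not_gt hxa) |>.1

/-- If `q = p'` is continuous on `[0,R)` with `p 0 = 0`, `q 0 > 0`, and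
`r p q - r p³ + p² = 8λr²` on `(0,R)`, then `q > 0` on `[0,R)`. -/
lemma deriv_pos_of_first_order_ODE {lam R : ℝ} (hlam : 0 < lam) {p q : ℝ → ℝ}
    (hp : ContinuousOn p (Ico 0 R)) (hq : ContinuousOn q (Ico 0 R))
    (hd : ∀ r ∈ Ioo 0 R, HasDerivAt p (q r) r) (h0 : p 0 = 0) (h0' : 0 < q 0)
    (hODE : ∀ r ∈ Ioo 0 R, r * p r * q r - r * (p r) ^ 3 + (p r) ^ 2 = 8 * lam * r ^ 2) :
    ∀ r ∈ Ico 0 R, 0 < q r := by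
  intro b hb
  by_contra! hqb
  have hsub : Icc 0 b ⊆ Ico 0 R := fun x hx => ⟨hx.1, hx.2.trans_lt hb.2⟩
  have hcl : IsClosed (Icc 0 b ∩ q ⁻¹' Iic 0) :=
    (hq.mono hsub).preimage_isClosed_of_isClosed isClosed_Icc isClosed_Iic
  obtain ⟨a, ⟨haI, hqa⟩, hmin⟩ :=
    (isCompact_Icc.of_isClosed_subset hcl inter_subset_left).exists_isLeast
      ⟨b, ⟨hb.1, le_rfl⟩, hqb⟩
  replace hqa : q a ≤ 0 := hqa
  have ha0 : 0 < a := haI.1.lt_of_ne <| by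
    rintro rfl
    exact hqa.not_gt h0'
  have haR : a ∈ Ioo 0 R := ⟨ha0, (hsub haI).2⟩
  have hpos : ∀ x ∈ Ioo 0 a, 0 < q x := fun x hx => by
    by_contra! h
    exact hx.2.not_ge (hmin ⟨⟨hx.1.le, hx.2.le.trans haI.2⟩, h⟩)
  have hleft : ∀ᶠ x in 𝓝[<] a, x ∈ Ioo 0 a := Ioo_mem_nhdsLT ha0
  have hqa0 : q a = 0 := by
    refine hqa.antisymm (ge_of_tendsto (x := 𝓝[<] a) (f := q) ?_
      (hleft.mono fun x hx => (hpos x hx).le))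
    exact ((hq.continuousAt (Ico_mem_nhds haR.1 haR.2)).tendsto).mono_left nhdsWithin_le_nhds
  have hmono : StrictMonoOn p (Icc 0 a) := by
    refine strictMonoOn_of_deriv_pos (convex_Icc 0 a)
      (hp.mono fun x hx => ⟨hx.1, hx.2.trans_lt haR.2⟩) fun x hx => ?_
    rw [interior_Icc] at hx
    rw [(hd x ⟨hx.1, hx.2.trans haR.2⟩).deriv]
    exact hpos x hx
  have hppos : ∀ x ∈ Ioc 0 a, 0 < p x := fun x hx =>
    h0 ▸ hmono ⟨le_rfl, ha0.le⟩ ⟨hx.1.le, hx.2⟩ hx.1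
  have hg : ∀ x ∈ Ioo 0 R, 8 * lam * x + p x ^ 3 - p x ^ 2 / x = p x * q x := fun x hx => by
    have := hx.1.ne'
    field_simp
    linarith [hODE x hx]
  have hder : HasDerivAt (fun x => 8 * lam * x + p x ^ 3 - p x ^ 2 / x)
      (8 * lam + p a ^ 2 / a ^ 2) a := by
    have hpa := hd a haR
    rw [hqa0] at hpa
    refine ((((hasDerivAt_id' a).const_mul (8 * lam)).add (hpa.pow 3)).sub
      ((hpa.pow 2).div (hasDerivAt_id' a) ha0.ne')).congr_deriv ?_
    simp only [Pi.pow_apply]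
    ring
  have hneg := hder.eventually_neg_left (by positivity) (by simp [hg a haR, hqa0])
  obtain ⟨x, hx, hxI⟩ := (hneg.and hleft).exists
  rw [hg x ⟨hxI.1, hxI.2.trans haR.2⟩] at hx
  exact hx.not_gt (mul_pos (hppos x ⟨hxI.1, hxI.2.le⟩) (hpos x hxI))


/-- an ODE argument. If `v` is `C²` on `[0,R)` (one-sided at `0`) and
`C³` on `(0,R)` with `v'(0) = 0`, `v''(0) > 0`, and for every `r ∈ (0,R)`:
`r v' v'' − r (v')³ + (v')² = 8λr²` and `v'' − (v')² + 3v'/r > 0`,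
then `v'' > 0` on `[0,R)`. Here the derivatives are taken within `[0,∞)`, so that
they agree with the one-sided derivatives at `0` and with the ordinary
derivatives on `(0,R)`. -/
theorem second_deriv_pos_of_radial_ODE
    (lam R : ℝ) (hlam : 0 < lam) (hR : 0 < R)
    (v : ℝ → ℝ)
    (v' : ℝ → ℝ) (hv' : v' = derivWithin v (Set.Ici 0))
    (v'' : ℝ → ℝ) (hv'' : v'' = derivWithin v' (Set.Ici 0))
    (hC2 : ContDiffOn ℝ 2 v (Set.Ico 0 R))
    (hC3 : ContDiffOn ℝ 3 v (Set.Ioo 0 R))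
    (h0 : v' 0 = 0) (h0' : 0 < v'' 0)
    (hODE : ∀ r ∈ Set.Ioo 0 R,
      r * v' r * v'' r - r * (v' r)^3 + (v' r)^2 = 8 * lam * r^2)
    (hsub : ∀ r ∈ Set.Ioo 0 R, 0 < v'' r - (v' r)^2 + 3 * v' r / r) :
    ∀ r ∈ Set.Ico 0 R, 0 < v'' r := by
  have hu : UniqueDiffOn ℝ (Ico 0 R) := uniqueDiffOn_Ico 0 R
  have hp : ContDiffOn ℝ 1 v' (Ico 0 R) := by
    refine (hC2.derivWithin hu (m := 1) (by norm_num)).congr fun x hx => ?_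
    rw [hv', derivWithin_Ico_eq_derivWithin_Ici v hx]
  have hq : ContinuousOn v'' (Ico 0 R) := by
    refine (hp.continuousOn_derivWithin hu le_rfl).congr fun x hx => ?_
    rw [hv'', derivWithin_Ico_eq_derivWithin_Ici v' hx]
  refine deriv_pos_of_first_order_ODE hlam hp.continuousOn hq (fun r hr => ?_) h0 h0' hODE
  have hd := (hp.differentiableOn one_ne_zero r (Ioo_subset_Ico_self hr)).differentiableAt
    (Ico_mem_nhds hr.1 hr.2)
  rw [hv'', derivWithin_of_mem_nhds (Ici_mem_nhds hr.1)]
  exact hd.hasDerivAt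
end

section
/- Let v₁, v₂, v₃, v₄, v₁₁, v₂₂ ∈ ℝ with v₁₁ > 0, v₂₂ > 0, and let λ > 0. Define F¹¹ = v₂₂ − (v₂²+v₄²), F²² = v₁₁ − (v₁²+v₃²), F¹² = v₁v₂ + v₃v₄, F²³ = −(v₁v₄ − v₂v₃). Assume v₁₁v₂₂ − (v₁²+v₃²)v₂₂ − (v₂²+v₄²)v₁₁ = λ. Then F¹¹ > 0, F²² > 0, the identity F¹¹F²² − (F¹²)² = λ + (F²³)² holds, and the symmetric matrix [[F¹¹, F¹²], [F¹², F²²]] is positive definite. -/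
/-- A symmetric real `2×2` matrix with positive leading principal minors is positive definite. -/
theorem posDef_fin_two_of_minors_pos {a b c : ℝ} (ha : 0 < a) (hdet : 0 < a * c - b ^ 2) :
    (!![a, b; b, c] : Matrix (Fin 2) (Fin 2) ℝ).PosDef := by
  refine Matrix.PosDef.of_dotProduct_mulVec_pos ?_ fun x hx => ?_
  · ext i j
    fin_cases i <;> fin_cases j <;> simp
  · have hform : star x ⬝ᵥ (!![a, b; b, c] : Matrix (Fin 2) (Fin 2) ℝ).mulVec x =
        a * x 0 ^ 2 + 2 * b * x 0 * x 1 + c * x 1 ^ 2 := by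
      simp [Matrix.mulVec, dotProduct, Fin.sum_univ_two]
      ring
    rw [hform]
    refine pos_of_mul_pos_right (a := a) ?_ ha.le
    have hsq : a * (a * x 0 ^ 2 + 2 * b * x 0 * x 1 + c * x 1 ^ 2) =
        (a * x 0 + b * x 1) ^ 2 + (a * c - b ^ 2) * x 1 ^ 2 := by ring
    rw [hsq]
    by_cases h1 : x 1 = 0
    · have h0 : x 0 ≠ 0 := fun h0 => hx <| by
        ext i
        fin_cases i <;> simp [h0, h1]
      rw [h1]
      simp only [mul_zero, add_zero]
      positivity
    · positivity

/-- algebraic positivity of the `2×2` coefficient block in the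
rank-2 case. -/
theorem rank_two_block_posdef
    (v₁ v₂ v₃ v₄ v₁₁ v₂₂ : ℝ) (h11 : 0 < v₁₁) (h22 : 0 < v₂₂)
    (lam : ℝ) (hlam : 0 < lam)
    (F11 F22 F12 F23 : ℝ)
    (hF11 : F11 = v₂₂ - (v₂^2 + v₄^2))
    (hF22 : F22 = v₁₁ - (v₁^2 + v₃^2))
    (hF12 : F12 = v₁ * v₂ + v₃ * v₄)
    (hF23 : F23 = -(v₁ * v₄ - v₂ * v₃))
    (hconstraint :
      v₁₁ * v₂₂ - (v₁^2 + v₃^2) * v₂₂ - (v₂^2 + v₄^2) * v₁₁ = lam) :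
    0 < F11 ∧ 0 < F22 ∧ F11 * F22 - F12^2 = lam + F23^2 ∧
      (!![F11, F12; F12, F22] : Matrix (Fin 2) (Fin 2) ℝ).PosDef := by
  have hpos11 : 0 < F11 := by
    refine pos_of_mul_pos_right (a := v₁₁) ?_ h11.le
    have : v₁₁ * F11 = lam + (v₁ ^ 2 + v₃ ^ 2) * v₂₂ := by rw [hF11, ← hconstraint]; ring
    rw [this]
    positivity
  have hpos22 : 0 < F22 := by
    refine pos_of_mul_pos_right (a := v₂₂) ?_ h22.le
    have : v₂₂ * F22 = lam + (v₂ ^ 2 + v₄ ^ 2) * v₁₁ := by rw [hF22, ← hconstraint]; ring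
    rw [this]
    positivity
  have hdet : F11 * F22 - F12 ^ 2 = lam + F23 ^ 2 := by
    rw [hF11, hF22, hF12, hF23, ← hconstraint]
    ring
  refine ⟨hpos11, hpos22, hdet, posDef_fin_two_of_minors_pos hpos11 ?_⟩
  rw [hdet]
  positivity
end

section
/- Let v₁, v₂, v₃, v₄, v₁₁, v₂₂, v₃₃ ∈ ℝ with v₁₁, v₂₂, v₃₃ > 0 and let λ > 0. Define F¹¹ = v₂₂ − (v₂²+v₄²) and F²² = (v₁₁+v₃₃) − (v₁²+v₃²), and assume the constraint (v₁₁+v₃₃)v₂₂ − (v₂²+v₄²)(v₁₁+v₃₃) − (v₁²+v₃²)v₂₂ = λ. Then F¹¹ > 0, F²² > 0, F²²v₂₂ = λ + (v₂²+v₄²)(v₁₁+v₃₃), and the symmetric 2×2 matrix A₁ with entries A₁[1,1] = (F¹¹/(F²²v₂₂·v₁₁))·((v₂²+v₄²)v₃₃ + λ), A₁[1,2] = A₁[2,1] = −(F¹¹/(F²²v₂₂))·(v₂²+v₄²), A₁[2,2] = (F¹¹/(F²²v₂₂·v₃₃))·((v₂²+v₄²)v₁₁ + λ) is positive definite, with determinant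 det A₁ = λ·(F¹¹)²/(F²²v₂₂·v₁₁·v₃₃). -/
/-- Sylvester's criterion for real symmetric `2 × 2` matrices. -/
theorem Matrix.posDef_fin_two_of_pos {a b c : ℝ} (ha : 0 < a)
    (hdet : 0 < (!![a, b; b, c] : Matrix (Fin 2) (Fin 2) ℝ).det) :
    (!![a, b; b, c] : Matrix (Fin 2) (Fin 2) ℝ).PosDef := by
  rw [Matrix.det_fin_two_of] at hdet
  refine Matrix.PosDef.of_dotProduct_mulVec_pos ?_ fun x hx => ?_
  · ext i j
    fin_cases i <;> fin_cases j <;> simp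
  · have hform : dotProduct (star x) (Matrix.mulVec !![a, b; b, c] x) =
        ((a * x 0 + b * x 1) ^ 2 + (a * c - b * b) * x 1 ^ 2) / a := by
      simp [Matrix.mulVec, dotProduct, Fin.sum_univ_two]
      field_simp
      ring
    rw [hform]
    refine div_pos ?_ ha
    rcases eq_or_ne (x 1) 0 with h1 | h1
    · have h0 : x 0 ≠ 0 := fun h0 => hx <| by
        ext i
        fin_cases i <;> simp [h0, h1]
      rw [h1]
      ring_nf
      positivity
    · have := mul_pos hdet (pow_pos (abs_pos.mpr h1) 2)
      rw [sq_abs] at this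
      positivity

/-- positive definiteness of the matrix `A₁` in the rank-3 case
(Claim 2), together with the exact value of its determinant. -/
theorem claim2_A1_posdef
    (v₁ v₂ v₃ v₄ v₁₁ v₂₂ v₃₃ : ℝ)
    (h11 : 0 < v₁₁) (h22 : 0 < v₂₂) (h33 : 0 < v₃₃)
    (lam : ℝ) (hlam : 0 < lam)
    (F11 F22 : ℝ)
    (hF11 : F11 = v₂₂ - (v₂^2 + v₄^2))
    (hF22 : F22 = (v₁₁ + v₃₃) - (v₁^2 + v₃^2))
    (hconstraint :
      (v₁₁ + v₃₃) * v₂₂ - (v₂^2 + v₄^2) * (v₁₁ + v₃₃) - (v₁^2 + v₃^2) * v₂₂ = lam)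
    (A₁ : Matrix (Fin 2) (Fin 2) ℝ)
    (hA₁ : A₁ = !![F11 / (F22 * v₂₂ * v₁₁) * ((v₂^2 + v₄^2) * v₃₃ + lam),
                   -(F11 / (F22 * v₂₂)) * (v₂^2 + v₄^2);
                   -(F11 / (F22 * v₂₂)) * (v₂^2 + v₄^2),
                   F11 / (F22 * v₂₂ * v₃₃) * ((v₂^2 + v₄^2) * v₁₁ + lam)]) :
    0 < F11 ∧ 0 < F22 ∧
      F22 * v₂₂ = lam + (v₂^2 + v₄^2) * (v₁₁ + v₃₃) ∧
      A₁.PosDef ∧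
      A₁.det = lam * F11^2 / (F22 * v₂₂ * v₁₁ * v₃₃) := by
  have hF11_pos : 0 < F11 := by
    refine pos_of_mul_pos_left (b := v₁₁ + v₃₃) ?_ (by positivity)
    have : F11 * (v₁₁ + v₃₃) = lam + (v₁^2 + v₃^2) * v₂₂ := by
      rw [hF11]
      linarith
    rw [this]
    positivity
  have hD : F22 * v₂₂ = lam + (v₂^2 + v₄^2) * (v₁₁ + v₃₃) := by
    rw [hF22]
    linarith
  have hF22_pos : 0 < F22 := by
    refine pos_of_mul_pos_left (b := v₂₂) ?_ h22.le
    rw [hD]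
    positivity
  have hdet : A₁.det = lam * F11^2 / (F22 * v₂₂ * v₁₁ * v₃₃) := by
    have hD_pos : 0 < F22 * v₂₂ := by positivity
    rw [hA₁, Matrix.det_fin_two_of]
    generalize F22 * v₂₂ = D at hD hD_pos ⊢
    field_simp
    rw [hD]
    ring
  refine ⟨hF11_pos, hF22_pos, hD, ?_, hdet⟩
  have hdet_pos : 0 < A₁.det := by
    rw [hdet]
    positivity
  rw [hA₁] at hdet_pos ⊢
  exact Matrix.posDef_fin_two_of_pos (by positivity) hdet_pos
end

section
/- Let v₁, v₂, v₃, v₄, v₁₁, v₂₂, v₃₃ ∈ ℝ with v₁₁, v₂₂, v₃₃ > 0 and let λ > 0. Define F¹¹ = v₂₂ − (v₂²+v₄²), F²² = (v₁₁+v₃₃) − (v₁²+v₃²), F¹² = v₁v₂ + v₃v₄, F²³ = −(v₁v₄ − v₂v₃), and assume the constraint (v₁₁+v₃₃)v₂₂ − (v₂²+v₄²)(v₁₁+v₃₃) − (v₁²+v₃²)v₂₂ = λ. Then the symmetric 3×3 matrix A₂ with entries A₂[1,1] = ((v₁²+v₃²)v₂₂ + λ)/(v₁₁v₃₃), A₂[1,2]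 = F²³/v₁₁, A₂[1,3] = F¹²/v₃₃, A₂[2,2] = (F¹¹F²² − (F¹²)²)·((v₂²+v₄²)v₃₃ + λ)/(F¹¹v₁₁·F²²v₂₂), A₂[2,3] = F¹²F²³(v₂²+v₄²)/(F¹¹·F²²v₂₂), A₂[3,3] = (F¹¹F²² − (F²³)²)·((v₂²+v₄²)v₁₁ + λ)/(F²²v₂₂·F¹¹v₃₃) is positive semidefinite, and its determinant satisfies det A₂ ≥ λ²·F²²·(v₂²+v₄²)² / (F¹¹·v₁₁·v₃₃·(F²²v₂₂)²). -/
/-- A real symmetric `3 × 3` matrix whose first two leading principal minors are positive and whose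
determinant is nonnegative is positive semidefinite. -/
theorem posSemidef_fin_three_of_leading_minors {a b c d e f : ℝ} (ha : 0 < a)
    (hM : 0 < a * d - b ^ 2) (hdet : 0 ≤ (!![a, b, c; b, d, e; c, e, f] : Matrix _ _ ℝ).det) :
    (!![a, b, c; b, d, e; c, e, f] : Matrix _ _ ℝ).PosSemidef := by
  refine Matrix.PosSemidef.of_dotProduct_mulVec_nonneg ?_ fun x => ?_
  · ext i j
    fin_cases i <;> fin_cases j <;> simp
  · simp only [Matrix.det_fin_three, Matrix.of_apply, Matrix.cons_val] at hdet
    simp only [dotProduct, Matrix.mulVec, Fin.sum_univ_three, Matrix.of_apply, Matrix.cons_val,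
      Pi.star_apply, star_trivial]
    refine (mul_nonneg_iff_of_pos_left (mul_pos ha hM)).1 ?_
    have key := add_nonneg (add_nonneg
      (mul_nonneg hM.le (sq_nonneg (a * x 0 + b * x 1 + c * x 2)))
      (sq_nonneg ((a * d - b ^ 2) * x 1 + (a * e - b * c) * x 2)))
      (mul_nonneg (mul_nonneg ha.le hdet) (sq_nonneg (x 2)))
    linear_combination key


/-- positive semidefiniteness of the matrix `A₂` in the rank-3 case
(Claim 3), together with a lower bound for its determinant. -/
theorem claim3_A2_possemidef
    (v₁ v₂ v₃ v₄ v₁₁ v₂₂ v₃₃ : ℝ)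
    (h11 : 0 < v₁₁) (h22 : 0 < v₂₂) (h33 : 0 < v₃₃)
    (lam : ℝ) (hlam : 0 < lam)
    (F11 F22 F12 F23 : ℝ)
    (hF11 : F11 = v₂₂ - (v₂^2 + v₄^2))
    (hF22 : F22 = (v₁₁ + v₃₃) - (v₁^2 + v₃^2))
    (hF12 : F12 = v₁ * v₂ + v₃ * v₄)
    (hF23 : F23 = -(v₁ * v₄ - v₂ * v₃))
    (hconstraint :
      (v₁₁ + v₃₃) * v₂₂ - (v₂^2 + v₄^2) * (v₁₁ + v₃₃) - (v₁^2 + v₃^2) * v₂₂ = lam)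
    (A₂ : Matrix (Fin 3) (Fin 3) ℝ)
    (hA₂ : A₂ = !![((v₁^2 + v₃^2) * v₂₂ + lam) / (v₁₁ * v₃₃),
                   F23 / v₁₁,
                   F12 / v₃₃;
                   F23 / v₁₁,
                   (F11 * F22 - F12^2) * ((v₂^2 + v₄^2) * v₃₃ + lam) / (F11 * v₁₁ * (F22 * v₂₂)),
                   F12 * F23 * (v₂^2 + v₄^2) / (F11 * (F22 * v₂₂));
                   F12 / v₃₃,
                   F12 * F23 * (v₂^2 + v₄^2) / (F11 * (F22 * v₂₂)),
                   (F11 * F22 - F23^2) * ((v₂^2 + v₄^2) * v₁₁ + lam) / (F22 * v₂₂ * (F11 * v₃₃))]) :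
    A₂.PosSemidef ∧
      lam^2 * F22 * (v₂^2 + v₄^2)^2 / (F11 * v₁₁ * v₃₃ * (F22 * v₂₂)^2) ≤ A₂.det := by
  set s := v₁ ^ 2 + v₃ ^ 2 with hs
  set p := v₂ ^ 2 + v₄ ^ 2 with hp
  have hs0 : 0 ≤ s := by positivity
  have hp0 : 0 ≤ p := by positivity
  have hxy : F12 ^ 2 + F23 ^ 2 = s * p := by rw [hF12, hF23, hs, hp]; ring
  have hsum : s * v₂₂ + lam = (v₁₁ + v₃₃) * F11 := by rw [hF11]; linear_combination -hconstraint
  have hf : 0 < F11 := by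
    have : 0 < (v₁₁ + v₃₃) * F11 := by rw [← hsum]; positivity
    exact pos_of_mul_pos_right this (by positivity)
  have hprod : F11 * F22 = lam + F12 ^ 2 + F23 ^ 2 := by
    rw [add_assoc, hxy, hF11, hF22]; linear_combination hconstraint
  have hD : F22 * v₂₂ = lam + p * (v₁₁ + v₃₃) := by rw [hF22]; linear_combination hconstraint
  have hDpos : 0 < lam + p * (v₁₁ + v₃₃) := by positivity
  have hF22pos : 0 < F22 := pos_of_mul_pos_left (hD ▸ hDpos) h22.le
  have e1 : F11 * F22 - F12 ^ 2 = lam + F23 ^ 2 := by linear_combination hprod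
  have e2 : F11 * F22 - F23 ^ 2 = lam + F12 ^ 2 := by linear_combination hprod
  rw [hsum, e1, e2, hD] at hA₂
  rw [hD]
  have hdet : A₂.det = lam ^ 2 * ((v₁₁ + v₃₃) * (p * v₃₃ + lam) * (p * v₁₁ + lam)
      + v₁₁ * (p * v₁₁ + lam) * F23 ^ 2 + v₃₃ * (p * v₃₃ + lam) * F12 ^ 2)
      / (F11 * (lam + p * (v₁₁ + v₃₃)) ^ 2 * v₁₁ ^ 2 * v₃₃ ^ 2) := by
    rw [hA₂]
    simp only [Matrix.det_fin_three, Matrix.of_apply, Matrix.cons_val]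
    clear_value s p
    clear hA₂ hprod hD hsum hxy e1 e2 hF11 hF22 hF12 hF23 hconstraint
    field_simp
    ring
  have hbound : lam ^ 2 * F22 * p ^ 2 / (F11 * v₁₁ * v₃₃ * (lam + p * (v₁₁ + v₃₃)) ^ 2)
      ≤ A₂.det := by
    have hnum : F22 * p ^ 2 * (v₁₁ * v₃₃) ≤ (v₁₁ + v₃₃) * (p * v₃₃ + lam) * (p * v₁₁ + lam)
        + v₁₁ * (p * v₁₁ + lam) * F23 ^ 2 + v₃₃ * (p * v₃₃ + lam) * F12 ^ 2 := by
      have : 0 ≤ s * p ^ 2 * (v₁₁ * v₃₃) + (v₁₁ + v₃₃) * lam * (lam + p * (v₁₁ + v₃₃))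
        + v₁₁ * (p * v₁₁ + lam) * F23 ^ 2 + v₃₃ * (p * v₃₃ + lam) * F12 ^ 2 := by positivity
      rw [hF22]
      linear_combination this
    calc _ = lam ^ 2 * (F22 * p ^ 2 * (v₁₁ * v₃₃))
          / (F11 * (lam + p * (v₁₁ + v₃₃)) ^ 2 * v₁₁ ^ 2 * v₃₃ ^ 2) := by field_simp
      _ ≤ A₂.det := by rw [hdet]; gcongr
  refine ⟨?_, hbound⟩
  have hdet0 : 0 ≤ A₂.det := le_trans (by positivity) hbound
  rw [hA₂] at hdet0 ⊢
  refine posSemidef_fin_three_of_leading_minors (by positivity) ?_ hdet0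
  have : (v₁₁ + v₃₃) * F11 / (v₁₁ * v₃₃)
        * ((lam + F23 ^ 2) * (p * v₃₃ + lam) / (F11 * v₁₁ * (lam + p * (v₁₁ + v₃₃))))
        - (F23 / v₁₁) ^ 2
      = lam * ((v₁₁ + v₃₃) * (p * v₃₃ + lam) + F23 ^ 2 * v₁₁)
        / (v₁₁ ^ 2 * v₃₃ * (lam + p * (v₁₁ + v₃₃))) := by
    clear_value s p
    field_simp
    ring
  rw [this]
  positivity
end

section
/- Let n > l ≥ 0 be integers and M > 0 a real constant. Then there exists a constant C > 0 depending only on n and M such that the following holds: for all real numbers λ_{l+1}, …, λ_n with 0 < λ_i ≤ M, all real numbers γ_{l+1}, …, γ_n with 1/M ≤ γ_i ≤ M, every symmetric real array (w_{ij})_{l+1 ≤ i,j ≤ n} (w_{ij} = w_{ji}), and all D > 0 and δ > 0, one has ∑_{l+1 ≤ i,j ≤ n} |w_{ij}| ≤ C(1 + 2D/δ + D)·(σ₁ + |∑_{l+1 ≤ i ≤ n} γ_i w_{ii}|) + (δ/(2D))·(1/σ₁)·∑_{l+1 ≤ i,j ≤ n, i ≠ j} w_{ij}² + (C/D)·(1/σ₁³)·∑_{l+1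 ≤ i ≤ n} V_i², where σ₁ = ∑_{l+1 ≤ i ≤ n} λ_i and V_i = w_{ii}·σ₁ − λ_i·(∑_{l+1 ≤ j ≤ n} w_{jj}). -/
/-- Young's inequality with a weight `a`. -/
theorem abs_le_mul_sq_add {a : ℝ} (ha : 0 < a) (x : ℝ) : |x| ≤ a * x ^ 2 + 1 / (4 * a) := by
  have h : a * x ^ 2 + 1 / (4 * a) - |x| = a * (|x| - 1 / (2 * a)) ^ 2 := by
    rw [← sq_abs x]
    field_simp
    ring
  have : 0 ≤ a * (|x| - 1 / (2 * a)) ^ 2 := by positivity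
  linarith

/-- The entries off the diagonal are controlled by their squares. -/
theorem sum_erase_abs_le (s : Finset ℕ) (w : ℕ → ℕ → ℝ) {a : ℝ} (ha : 0 < a) :
    ∑ i ∈ s, ∑ j ∈ s.erase i, |w i j| ≤
      a * ∑ i ∈ s, ∑ j ∈ s.erase i, (w i j) ^ 2 + (s.card : ℝ) ^ 2 * (1 / (4 * a)) := by
  have h : ∀ i ∈ s, ∑ j ∈ s.erase i, |w i j| ≤
      a * ∑ j ∈ s.erase i, (w i j) ^ 2 + (s.card : ℝ) * (1 / (4 * a)) := by
    intro i _
    calc ∑ j ∈ s.erase i, |w i j|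
        ≤ ∑ j ∈ s.erase i, (a * (w i j) ^ 2 + 1 / (4 * a)) :=
          Finset.sum_le_sum fun j _ => abs_le_mul_sq_add ha _
      _ = a * ∑ j ∈ s.erase i, (w i j) ^ 2 + ((s.erase i).card : ℝ) * (1 / (4 * a)) := by
          rw [Finset.sum_add_distrib, ← Finset.mul_sum, Finset.sum_const, nsmul_eq_mul]
      _ ≤ _ := by
          gcongr
          exact Finset.erase_subset i s
  refine (Finset.sum_le_sum h).trans_eq ?_
  rw [Finset.sum_add_distrib, ← Finset.mul_sum, Finset.sum_const, nsmul_eq_mul]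
  ring

/-- The diagonal is controlled by its weighted trace and its deviation from a multiple of `lam`. -/
theorem sum_abs_mul_le {s : Finset ℕ} {M : ℝ} (hM : 0 < M) {lam γ : ℕ → ℝ} (x : ℕ → ℝ)
    (hlam : ∀ i ∈ s, 0 < lam i) (hγ : ∀ i ∈ s, 1 / M ≤ γ i ∧ γ i ≤ M) :
    (∑ i ∈ s, |x i|) * ∑ i ∈ s, lam i ≤
      M * |∑ i ∈ s, γ i * x i| * ∑ i ∈ s, lam i
        + (1 + M ^ 2) * ∑ i ∈ s, |x i * ∑ k ∈ s, lam k - lam i * ∑ j ∈ s, x j| := by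
  set S := ∑ i ∈ s, lam i with hS
  set T := ∑ i ∈ s, x i with hT
  set G := ∑ i ∈ s, γ i * x i with hG
  set A := ∑ i ∈ s, |x i * S - lam i * T| with hA
  have hS0 : 0 ≤ S := Finset.sum_nonneg fun i hi => (hlam i hi).le
  have key : (∑ i ∈ s, γ i * lam i) * T = G * S - ∑ i ∈ s, γ i * (x i * S - lam i * T) := by
    rw [hG, Finset.sum_mul, Finset.sum_mul, ← Finset.sum_sub_distrib]
    exact Finset.sum_congr rfl fun i _ => by ring
  have hlow : S / M ≤ ∑ i ∈ s, γ i * lam i := by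
    rw [hS, Finset.sum_div]
    refine Finset.sum_le_sum fun i hi => ?_
    have := mul_le_mul_of_nonneg_right (hγ i hi).1 (hlam i hi).le
    calc lam i / M = 1 / M * lam i := by ring
      _ ≤ _ := this
  have hV : |∑ i ∈ s, γ i * (x i * S - lam i * T)| ≤ M * A := by
    rw [hA, Finset.mul_sum]
    refine (Finset.abs_sum_le_sum_abs _ _).trans (Finset.sum_le_sum fun i hi => ?_)
    have h0 : 0 ≤ γ i := le_trans (by positivity) (hγ i hi).1
    rw [abs_mul, abs_of_nonneg h0]
    exact mul_le_mul_of_nonneg_right (hγ i hi).2 (abs_nonneg _)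
  have hT' : S / M * |T| ≤ |G| * S + M * A := by
    calc S / M * |T| ≤ (∑ i ∈ s, γ i * lam i) * |T| :=
          mul_le_mul_of_nonneg_right hlow (abs_nonneg _)
      _ = |(∑ i ∈ s, γ i * lam i) * T| := by
          rw [abs_mul, abs_of_nonneg (le_trans (by positivity) hlow)]
      _ ≤ |G * S| + |∑ i ∈ s, γ i * (x i * S - lam i * T)| := by
          rw [key]
          exact abs_sub _ _
      _ ≤ |G| * S + M * A := by
          rw [abs_mul, abs_of_nonneg hS0]
          linarith
  have hST : S * |T| ≤ M * |G| * S + M ^ 2 * A := by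
    have := mul_le_mul_of_nonneg_left hT' hM.le
    calc S * |T| = M * (S / M * |T|) := by field_simp
      _ ≤ _ := this
      _ = _ := by ring
  have hsum : (∑ i ∈ s, |x i|) * S ≤ A + S * |T| := by
    rw [Finset.sum_mul, hA, hS, Finset.sum_mul, ← Finset.sum_add_distrib, ← hS]
    refine Finset.sum_le_sum fun i hi => ?_
    calc |x i| * S = |(x i * S - lam i * T) + lam i * T| := by
          rw [sub_add_cancel, abs_mul, abs_of_nonneg hS0]
      _ ≤ |x i * S - lam i * T| + |lam i * T| := abs_add_le _ _
      _ = _ := by rw [abs_mul (lam i), abs_of_pos (hlam i hi)]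
  linarith


/-- Bian–Guan, Lemma 3.3: for integers `n > l ≥ 0` and `M > 0`
there is `C > 0` depending only on `n` and `M` such that for all
`0 < λᵢ ≤ M`, `1/M ≤ γᵢ ≤ M` (`l+1 ≤ i ≤ n`), every symmetric array `w`, and all
`D > 0`, `δ > 0`:
`∑|wᵢⱼ| ≤ C(1 + 2D/δ + D)(σ₁ + |∑γᵢwᵢᵢ|) + (δ/2D)(1/σ₁)∑_{i≠j} wᵢⱼ²
 + (C/D)(1/σ₁³)∑Vᵢ²`, where `σ₁ = ∑λᵢ` and `Vᵢ = wᵢᵢσ₁ − λᵢ∑wⱼⱼ`. -/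
theorem bian_guan_lemma_3_3
    (n : ℕ) (M : ℝ) (hM : 0 < M) :
    ∃ C : ℝ, 0 < C ∧
      ∀ l : ℕ, l < n →
      ∀ lam γ : ℕ → ℝ, ∀ w : ℕ → ℕ → ℝ,
        (∀ i ∈ Finset.Icc (l+1) n, 0 < lam i ∧ lam i ≤ M) →
        (∀ i ∈ Finset.Icc (l+1) n, 1/M ≤ γ i ∧ γ i ≤ M) →
        (∀ i ∈ Finset.Icc (l+1) n, ∀ j ∈ Finset.Icc (l+1) n, w i j = w j i) →
        ∀ D : ℝ, 0 < D → ∀ δ : ℝ, 0 < δ →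
          (∑ i ∈ Finset.Icc (l+1) n, ∑ j ∈ Finset.Icc (l+1) n, |w i j|) ≤
            C * (1 + 2*D/δ + D) *
                ((∑ i ∈ Finset.Icc (l+1) n, lam i) +
                  |∑ i ∈ Finset.Icc (l+1) n, γ i * w i i|)
              + (δ / (2*D)) * (1 / (∑ i ∈ Finset.Icc (l+1) n, lam i)) *
                  (∑ i ∈ Finset.Icc (l+1) n,
                    ∑ j ∈ (Finset.Icc (l+1) n).erase i, (w i j)^2)
              + (C / D) * (1 / (∑ i ∈ Finset.Icc (l+1) n, lam i)^3) *
                  (∑ i ∈ Finset.Icc (l+1) n,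
                    (w i i * (∑ k ∈ Finset.Icc (l+1) n, lam k)
                      - lam i * (∑ j ∈ Finset.Icc (l+1) n, w j j))^2) := by
  refine ⟨M + (1 + M ^ 2) * (1 + n) + (n : ℝ) ^ 2, by positivity, ?_⟩
  intro l hl lam γ w hlam hγ _ D hD δ hδ
  set s := Finset.Icc (l + 1) n with hs
  have hcard : (s.card : ℝ) ≤ n := by
    rw [hs, Nat.card_Icc]
    exact_mod_cast (by omega : n + 1 - (l + 1) ≤ n)
  have hne : s.Nonempty := ⟨n, by rw [hs, Finset.mem_Icc]; omega⟩
  have hdiag := sum_abs_mul_le hM (fun i => w i i) (fun i hi => (hlam i hi).1) hγ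
  have hS : 0 < ∑ i ∈ s, lam i := Finset.sum_pos (fun i hi => (hlam i hi).1) hne
  have hsplit : ∑ i ∈ s, ∑ j ∈ s, |w i j| =
      ∑ i ∈ s, |w i i| + ∑ i ∈ s, ∑ j ∈ s.erase i, |w i j| := by
    rw [← Finset.sum_add_distrib]
    exact Finset.sum_congr rfl fun i hi => (Finset.add_sum_erase s (fun j => |w i j|) hi).symm
  rw [hsplit]
  beta_reduce at hdiag
  set S := ∑ i ∈ s, lam i
  set G := |∑ i ∈ s, γ i * w i i|
  set T := ∑ j ∈ s, w j j
  have hG : 0 ≤ G := abs_nonneg _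
  have hoff := sum_erase_abs_le s w (a := δ / (2 * D) * (1 / S)) (by positivity)
  set R := ∑ i ∈ s, ∑ j ∈ s.erase i, (w i j) ^ 2
  have hoff' : ∑ i ∈ s, ∑ j ∈ s.erase i, |w i j| ≤
      δ / (2 * D) * (1 / S) * R + (n : ℝ) ^ 2 * (2 * D / δ * S) := by
    refine hoff.trans ?_
    have e : 1 / (4 * (δ / (2 * D) * (1 / S))) = 2 * D / δ * S / 4 := by
      field_simp
    rw [e]
    gcongr
    have : 0 ≤ 2 * D / δ * S := by positivity
    linarith
  have inv_S : 1 / D * (1 / S ^ 3) * S = 1 / (D * S ^ 2) := by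
    field_simp
  have hV : ∑ i ∈ s, |w i i * S - lam i * T| ≤
      (1 / D * (1 / S ^ 3) * ∑ i ∈ s, (w i i * S - lam i * T) ^ 2 + n * (D * S)) * S := by
    calc ∑ i ∈ s, |w i i * S - lam i * T|
        ≤ ∑ i ∈ s, (1 / (D * S ^ 2) * (w i i * S - lam i * T) ^ 2
            + 1 / (4 * (1 / (D * S ^ 2)))) :=
          Finset.sum_le_sum fun i _ => abs_le_mul_sq_add (by positivity) _
      _ = 1 / (D * S ^ 2) * ∑ i ∈ s, (w i i * S - lam i * T) ^ 2
            + (s.card : ℝ) * (D * S ^ 2 / 4) := by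
          rw [Finset.sum_add_distrib, ← Finset.mul_sum, Finset.sum_const, nsmul_eq_mul]
          congr 2
          field_simp
      _ ≤ 1 / (D * S ^ 2) * ∑ i ∈ s, (w i i * S - lam i * T) ^ 2 + n * (D * S ^ 2) := by
          gcongr
          have : 0 ≤ D * S ^ 2 := by positivity
          linarith
      _ = _ := by
          rw [← inv_S]
          ring
  have hQ : 0 ≤ ∑ i ∈ s, (w i i * S - lam i * T) ^ 2 := Finset.sum_nonneg fun i _ => sq_nonneg _
  set Q := ∑ i ∈ s, (w i i * S - lam i * T) ^ 2
  have hdiag' : ∑ i ∈ s, |w i i| ≤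
      M * G + (1 + M ^ 2) * (1 / D * (1 / S ^ 3) * Q + n * (D * S)) := by
    refine le_of_mul_le_mul_right ?_ hS
    have := mul_le_mul_of_nonneg_left hV (by positivity : 0 ≤ 1 + M ^ 2)
    linarith
  set C := M + (1 + M ^ 2) * (1 + n) + (n : ℝ) ^ 2 with hC
  have hn : (0 : ℝ) ≤ n := n.cast_nonneg
  have hM2 : 0 ≤ (1 + M ^ 2) * n := by positivity
  have hC1 : M ≤ C := by nlinarith [sq_nonneg M, sq_nonneg (n : ℝ)]
  have hC2 : 1 + M ^ 2 ≤ C := by nlinarith [sq_nonneg (n : ℝ)]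
  have hC3 : (1 + M ^ 2) * n ≤ C := by nlinarith [sq_nonneg M, sq_nonneg (n : ℝ)]
  have hC4 : (n : ℝ) ^ 2 ≤ C := by nlinarith [sq_nonneg M]
  have hC0 : 0 ≤ C := hM.le.trans hC1
  have b1 : M * G ≤ C * G := by gcongr
  have b2 : (1 + M ^ 2) * (1 / D * (1 / S ^ 3) * Q) ≤ C / D * (1 / S ^ 3) * Q := by
    calc _ ≤ C * (1 / D * (1 / S ^ 3) * Q) := by gcongr
      _ = _ := by ring
  have b3 : (1 + M ^ 2) * n * (D * S) ≤ C * (D * S) := by gcongr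
  have b4 : (n : ℝ) ^ 2 * (2 * D / δ * S) ≤ C * (2 * D / δ * S) := by gcongr
  have b5 : 0 ≤ C * (2 * D / δ + D) * G := by positivity
  have b6 : 0 ≤ C * S := by positivity
  linarith
end
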